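/- Let G be a non-elementary hyperbolic group. For metric structures ρ, ρ' ∈ 𝒟(G) and any representatives d ∈ ρ, d' ∈ ρ', one has Λ(ρ,ρ') = Dil(d,d')·Dil(d',d). -/

import Mathlib

open Filter Set MeasureTheory Topology

noncomputable section

variable {X : Type*}

/-- The Gromov product `(x|y)_w` with respect to `d`. -/
def gp (d : X → X → ℝ) (w x y : X) : ℝ := (d x w + d y w - d x y) / 2

/-- `d` is a pseudometric. -/
def IsPseudometric (d : X → X → ℝ) : Prop :=
  (∀ x, d x x = 0) ∧ (∀ x y, d x y = d y x) ∧ (∀ x y z, d x z ≤ d x y + d y z)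

/-- `d` is `δ`-hyperbolic: the four-point Gromov product condition. -/
def GromovHyperbolic (d : X → X → ℝ) (δ : ℝ) : Prop :=
  ∀ x y z w, min (gp d w x y) (gp d w y z) - δ ≤ gp d w x z

/-- `d` is `α`-rough geodesic: any two points are joined by an `α`-rough geodesic. -/
def RoughGeodesic (d : X → X → ℝ) (α : ℝ) : Prop :=
  ∀ x y : X, ∃ (n : ℕ) (γ : ℕ → X), γ 0 = x ∧ γ n = y ∧
    ∀ i j : ℕ, i ≤ n → j ≤ n →
      |(i : ℝ) - (j : ℝ)| - α ≤ d (γ i) (γ j) ∧ d (γ i) (γ j) ≤ |(i : ℝ) - (j : ℝ)| + α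

variable {G : Type*} [Group G]

/-- Left invariance of a pseudometric on a group. -/
def LeftInvariant (d : G → G → ℝ) : Prop := ∀ g x y : G, d (g * x) (g * y) = d x y

/-- Word norm with respect to a subset `S`. -/
def wordNorm (S : Set G) (w : G) : ℕ :=
  sInf {k : ℕ | ∃ f : Fin k → G, (∀ i, f i ∈ S) ∧ (List.ofFn f).prod = w}

/-- Word metric with respect to a subset `S`. -/
def wordDist (S : Set G) (x y : G) : ℝ := (wordNorm S (x⁻¹ * y) : ℝ)

/-- `S` is a symmetric generating set. -/
def GenSymm (S : Set G) : Prop := (∀ s ∈ S, s⁻¹ ∈ S) ∧ Subgroup.closure S = ⊤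

/-- `d'` is quasi-isometric to `d` (via the identity map of `G`). -/
def QIsometric (d d' : G → G → ℝ) : Prop :=
  ∃ l1 l2 e : ℝ, 0 < l1 ∧ 0 < l2 ∧ 0 ≤ e ∧
    ∀ x y : G, d x y / l1 - e ≤ d' x y ∧ d' x y ≤ l2 * d x y + e

/-- Membership in `D(G)`: a left-invariant hyperbolic pseudometric on `G`
quasi-isometric to a word metric w.r.t. a finite symmetric generating set. -/
def InD (d : G → G → ℝ) : Prop :=
  IsPseudometric d ∧ LeftInvariant d ∧ (∃ δ ≥ (0 : ℝ), GromovHyperbolic d δ) ∧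
    ∃ S : Finset G, GenSymm (S : Set G) ∧ QIsometric (wordDist (S : Set G)) d

/-- `G` is a hyperbolic group: some word metric is Gromov hyperbolic. -/
def IsHyperbolicGroup (G : Type*) [Group G] : Prop :=
  ∃ S : Finset G, GenSymm (S : Set G) ∧ ∃ δ ≥ (0 : ℝ), GromovHyperbolic (wordDist (S : Set G)) δ

/-- `G` is non-elementary: it is not virtually abelian. -/
def NonElementary (G : Type*) [Group G] : Prop :=
  ¬ ∃ H : Subgroup G, H.FiniteIndex ∧ ∀ a ∈ H, ∀ b ∈ H, a * b = b * a

/-- Translation length `ℓ_d(x) = lim_n d(x^n,1)/n`; by Fekete's subadditivity lemma the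
limit exists and equals the infimum of `d(x^n,1)/n` over `n ≥ 1`. -/
def tlen (d : G → G → ℝ) (x : G) : ℝ :=
  sInf {r : ℝ | ∃ n : ℕ, r = d (x ^ (n + 1)) 1 / (n + 1)}

/-- Dilation `Dil(d,d') = sup_x ℓ_d(x)/ℓ_{d'}(x)` over infinite-order elements. -/
def Dil (d d' : G → G → ℝ) : ℝ :=
  sSup {r : ℝ | ∃ x : G, ¬ IsOfFinOrder x ∧ r = tlen d x / tlen d' x}

/-- Critical exponent `h(d) = lim_n log|B_d(n)|/n` (the limit exists, so it equals
the limsup used here). -/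
def hCrit (d : G → G → ℝ) : ℝ :=
  Filter.limsup (fun n : ℕ => Real.log (Set.ncard {x : G | d x 1 ≤ (n : ℝ)}) / (n : ℝ)) atTop

/-- `Λ(d1,d2)`: the infimum of `λ1·λ2` over quasi-isometry constants between `d1,d2`. -/
def Lam (d1 d2 : G → G → ℝ) : ℝ :=
  sInf {l : ℝ | ∃ l1 l2 A : ℝ, 0 < l1 ∧ 0 < l2 ∧ 0 ≤ A ∧ l = l1 * l2 ∧
    ∀ x y : G, d2 x y / l1 - A ≤ d1 x y ∧ d1 x y ≤ l2 * d2 x y + A}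

section Helpers

lemma hp_fp {d : X → X → ℝ} {δ : ℝ} (h : GromovHyperbolic d δ) (x y z w : X) :
    d x z + d y w ≤ d x y + d z w + 2 * δ ∨ d x z + d y w ≤ d y z + d x w + 2 * δ := by
  have := h x y z w
  unfold gp at this
  rcases le_total ((d x w + d y w - d x y) / 2) ((d y w + d z w - d y z) / 2) with h1 | h1
  · rw [min_eq_left h1] at this; left; linarith
  · rw [min_eq_right h1] at this; right; linarith

lemma hp_nonneg {d : X → X → ℝ} (h : IsPseudometric d) (x y : X) : 0 ≤ d x y := by
  obtain ⟨h0, hs, ht⟩ := h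
  have := ht x y x
  rw [h0, hs y x] at this; linarith

/-- Chain lemma. -/
lemma hp_chain {d : X → X → ℝ} {δ c ρ : ℝ} (r : X → ℝ) (p : ℕ → X) (hδ : 0 ≤ δ) (hc : 0 ≤ c)
    (h0 : ∀ x, d x x = 0)
    (hr : ∀ a b e, min ((r a + r b - d a b) / 2) ((r b + r e - d b e) / 2) - δ
      ≤ (r a + r e - d a e) / 2) (k : ℕ) :
    ∀ i j : ℕ, i ≤ j → j ≤ i + 2 ^ k → (∀ l, i ≤ l → l ≤ j → ρ ≤ r (p l)) →
      (∀ l, i ≤ l → l < j → d (p l) (p (l + 1)) ≤ c) →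
      ρ - c / 2 - k * δ ≤ (r (p i) + r (p j) - d (p i) (p j)) / 2 := by
  induction k with
  | zero =>
    intro i j hij hj hρ hd
    simp only [pow_zero] at hj
    have : j = i ∨ j = i + 1 := by omega
    rcases this with rfl | rfl
    · rw [h0]; have := hρ j le_rfl le_rfl; push_cast; linarith
    · have := hρ i le_rfl (by omega)
      have := hρ (i+1) (by omega) le_rfl
      have := hd i le_rfl (by omega)
      push_cast; linarith
  | succ k ih =>
    intro i j hij hj hρ hd
    rw [pow_succ] at hj
    have hm : ∃ m, i ≤ m ∧ m ≤ j ∧ m ≤ i + 2 ^ k ∧ j ≤ m + 2 ^ k := by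
      refine ⟨min j (i + 2 ^ k), ?_, ?_, ?_, ?_⟩ <;> omega
    obtain ⟨m, h1, h2, h3, h4⟩ := hm
    have e1 := ih i m h1 h3 (fun l a b => hρ l a (b.trans h2)) (fun l a b => hd l a (b.trans_le h2))
    have e2 := ih m j h2 h4 (fun l a b => hρ l (h1.trans a) b) (fun l a b => hd l (h1.trans a) b)
    have e3 := hr (p i) (p m) (p j)
    have := le_min e1 e2
    push_cast; linarith

lemma hp_growth (A B δ C : ℝ) (hA : 0 ≤ A) (hδ : 0 ≤ δ) :
    ∃ R0 : ℝ, 0 ≤ R0 ∧ ∀ R, R0 ≤ R → ∃ k : ℕ, A * R + B ≤ 2 ^ k ∧ k * δ + C < R := by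
  have h1 := tendsto_pow_const_div_const_pow_of_one_lt 1 (one_lt_two (α := ℝ))
  have h0 := tendsto_pow_const_div_const_pow_of_one_lt 0 (one_lt_two (α := ℝ))
  have h2 := (h1.const_mul (A * (2 * (δ + 1)))).add (h0.const_mul (A * (2 * (δ + 1)) + B))
  simp only [mul_zero, add_zero] at h2
  obtain ⟨k0, hk0⟩ := eventually_atTop.1 (h2.eventually (gt_mem_nhds one_pos))
  refine ⟨max (2 * (δ + 1) * (k0 + 1)) (2 * |C| + 1), by positivity, fun R hR => ?_⟩
  have hR1 := (le_max_left _ _).trans hR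
  have hR2 := (le_max_right _ _).trans hR
  have hpos : 0 < 2 * (δ + 1) := by positivity
  have hRn : 0 ≤ R := by have := abs_nonneg C; linarith
  refine ⟨⌊R / (2 * (δ + 1))⌋₊, ?_, ?_⟩
  · set k := ⌊R / (2 * (δ + 1))⌋₊ with hk
    have e1 : R / (2 * (δ + 1)) < k + 1 := Nat.lt_floor_add_one _
    rw [div_lt_iff₀ hpos] at e1
    have e2 : k0 ≤ k := by
      apply Nat.le_floor
      rw [le_div_iff₀ hpos]; nlinarith
    have e3 : A * (2 * (δ + 1)) * ((k : ℝ) ^ 1 / 2 ^ k) +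
        (A * (2 * (δ + 1)) + B) * ((k : ℝ) ^ 0 / 2 ^ k) < 1 := hk0 k e2
    have hp : (0:ℝ) < 2 ^ k := by positivity
    have e4 : (A * (2 * (δ + 1)) * (k + 1) + B) / 2 ^ k < 1 := by
      refine lt_of_eq_of_lt ?_ e3
      ring
    rw [div_lt_one hp] at e4
    have := mul_le_mul_of_nonneg_left e1.le hA
    nlinarith
  · have e1 : (⌊R / (2 * (δ + 1))⌋₊ : ℝ) ≤ R / (2 * (δ + 1)) := Nat.floor_le (by positivity)
    rw [le_div_iff₀ hpos] at e1
    have := le_abs_self C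
    have : (0:ℝ) ≤ (⌊R / (2 * (δ + 1))⌋₊ : ℝ) := by positivity
    nlinarith

/-- The virtual point at parameter `t` between `x` and `y`. -/
def hpR (d : X → X → ℝ) (x y : X) (t : ℝ) (z : X) : ℝ := max (d x z - t) (d y z - (d x y - t))

lemma hpR_hyp {d : X → X → ℝ} {δ : ℝ} (hm : IsPseudometric d) (h : GromovHyperbolic d δ)
    (x y : X) (t : ℝ) (a b e : X) :
    min ((hpR d x y t a + hpR d x y t b - d a b) / 2) ((hpR d x y t b + hpR d x y t e - d b e) / 2)
      - δ ≤ (hpR d x y t a + hpR d x y t e - d a e) / 2 := by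
  have key : hpR d x y t b + d a e ≤ hpR d x y t a + d b e + 2 * δ ∨
      hpR d x y t b + d a e ≤ hpR d x y t e + d a b + 2 * δ := by
    have a1 : d x a - t ≤ hpR d x y t a := le_max_left _ _
    have a2 : d y a - (d x y - t) ≤ hpR d x y t a := le_max_right _ _
    have e1 : d x e - t ≤ hpR d x y t e := le_max_left _ _
    have e2 : d y e - (d x y - t) ≤ hpR d x y t e := le_max_right _ _
    have hs := hm.2.1
    rcases max_choice (d x b - t) (d y b - (d x y - t)) with hb | hb
    · have hb' : hpR d x y t b = d x b - t := hb
      rcases hp_fp h x a b e with h1 | h1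
      · left; linarith
      · right; linarith
    · have hb' : hpR d x y t b = d y b - (d x y - t) := hb
      rcases hp_fp h y a b e with h1 | h1
      · left; linarith
      · right; linarith
  rcases key with h1 | h1
  · have := min_le_right ((hpR d x y t a + hpR d x y t b - d a b) / 2)
      ((hpR d x y t b + hpR d x y t e - d b e) / 2)
    linarith
  · have := min_le_left ((hpR d x y t a + hpR d x y t b - d a b) / 2)
      ((hpR d x y t b + hpR d x y t e - d b e) / 2)
    linarith

lemma hpR_tri {d : X → X → ℝ} {δ : ℝ} (hm : IsPseudometric d) (h : GromovHyperbolic d δ)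
    (x y : X) (t : ℝ) (a b : X) : d a b ≤ hpR d x y t a + hpR d x y t b + 2 * δ := by
  have a1 : d x a - t ≤ hpR d x y t a := le_max_left _ _
  have a2 : d y a - (d x y - t) ≤ hpR d x y t a := le_max_right _ _
  have e1 : d x b - t ≤ hpR d x y t b := le_max_left _ _
  have e2 : d y b - (d x y - t) ≤ hpR d x y t b := le_max_right _ _
  have hs := hm.2.1
  have s1 := hs a x
  have s2 := hs b y
  have s3 := hs a y
  rcases hp_fp h a x b y with h1 | h1 <;> linarith

/-- A descent step in the Morse argument. -/
lemma hp_step {d : X → X → ℝ} {δ c l e R : ℝ} (hm : IsPseudometric d) (h : GromovHyperbolic d δ)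
    (hδ : 0 ≤ δ) (hc : 0 ≤ c) (hl : 0 ≤ l) (hR : 1 ≤ R) (κ : ℕ)
    (hκ1 : l * (6 * R + 2 * δ + e) ≤ 2 ^ κ) (hκ2 : κ * δ + (1 + c / 2 + 2 * δ) < R)
    (x y : X) (n : ℕ) (p : ℕ → X) (p0 : p 0 = x) (pn : p n = y)
    (hs : ∀ i, i < n → d (p i) (p (i + 1)) ≤ c)
    (hq : ∀ i j, i ≤ j → j ≤ n → ((j : ℝ) - i) ≤ l * (d (p i) (p j) + e))
    (hgood : ∀ t, 0 ≤ t → t ≤ d x y → ∃ i, i ≤ n ∧ hpR d x y t (p i) ≤ R) :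
    ∀ t, 0 ≤ t → t ≤ d x y → ∃ i, i ≤ n ∧ hpR d x y t (p i) ≤ R - 1 := by
  intro t t0 tD
  by_contra hcon
  push Not at hcon
  have rx : hpR d x y t x = t := by
    unfold hpR; rw [hm.1, hm.2.1 y x]
    rw [max_eq_right (by linarith)]; ring
  have ry : hpR d x y t y = d x y - t := by
    unfold hpR; rw [hm.1]
    rw [max_eq_left (by linarith)]
  have hx := hcon 0 (Nat.zero_le _)
  have hy := hcon n le_rfl
  rw [p0, rx] at hx
  rw [pn, ry] at hy
  have hj : ∃ j, j ≤ n ∧ hpR d x y t (p j) ≤ 3 * R ∧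
      R - 1 ≤ (hpR d x y t x + hpR d x y t (p j) - d x (p j)) / 2 := by
    by_cases ht : 0 ≤ t - 2 * R
    · obtain ⟨j, hj, hjr⟩ := hgood (t - 2 * R) ht (by linarith)
      obtain ⟨a1, a2⟩ := max_le_iff.1 hjr
      refine ⟨j, hj, max_le (by linarith) (by linarith), ?_⟩
      have := hcon j hj
      rw [rx]; linarith
    · refine ⟨0, Nat.zero_le _, ?_, ?_⟩
      · rw [p0, rx]; linarith
      · rw [p0, rx, hm.1]; linarith
  have hk : ∃ k, k ≤ n ∧ hpR d x y t (p k) ≤ 3 * R ∧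
      R - 1 ≤ (hpR d x y t (p k) + hpR d x y t y - d (p k) y) / 2 := by
    by_cases ht : t + 2 * R ≤ d x y
    · obtain ⟨j, hj, hjr⟩ := hgood (t + 2 * R) (by linarith) (by linarith)
      obtain ⟨a1, a2⟩ := max_le_iff.1 hjr
      refine ⟨j, hj, max_le (by linarith) (by linarith), ?_⟩
      have := hcon j hj
      rw [ry, hm.2.1 (p j) y]; linarith
    · refine ⟨n, le_rfl, ?_, ?_⟩
      · rw [pn, ry]; linarith
      · rw [pn, ry, hm.1]; linarith
  obtain ⟨j, hjn, hj3, hjP⟩ := hj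
  obtain ⟨k, hkn, hk3, hkP⟩ := hk
  have hyp := hpR_hyp hm h x y t
  have main : ∀ i j, i ≤ j → j ≤ n → hpR d x y t (p i) ≤ 3 * R → hpR d x y t (p j) ≤ 3 * R →
      R - 1 - c / 2 - κ * δ ≤ (hpR d x y t (p i) + hpR d x y t (p j) - d (p i) (p j)) / 2 := by
    intro i j hij hjn hi hj
    refine hp_chain (hpR d x y t) p hδ hc hm.1 hyp κ i j hij ?_ ?_ ?_
    · have h1 := hq i j hij hjn
      have h2 := hpR_tri hm h x y t (p i) (p j)
      have h3 : l * (d (p i) (p j) + e) ≤ l * (6 * R + 2 * δ + e) :=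
        mul_le_mul_of_nonneg_left (by linarith) hl
      have h4 : (j : ℝ) ≤ ((i + 2 ^ κ : ℕ) : ℝ) := by push_cast; linarith
      exact_mod_cast h4
    · intro l _ h2; exact (hcon l (h2.trans hjn)).le
    · intro l _ h2; exact hs l (h2.trans_le hjn)
  have hjk : R - 1 - c / 2 - κ * δ ≤
      (hpR d x y t (p j) + hpR d x y t (p k) - d (p j) (p k)) / 2 := by
    rcases le_total j k with h1 | h1
    · exact main j k h1 hkn hj3 hk3
    · have := main k j h1 hjn hk3 hj3
      rw [hm.2.1 (p j) (p k)]; linarith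
  have hκδ : 0 ≤ κ * δ := by positivity
  have f1 := hyp x (p j) (p k)
  have g1 := le_min (hjP.trans' (by linarith : R - 1 - c / 2 - κ * δ ≤ R - 1)) hjk
  have g1' : R - 1 - c / 2 - κ * δ - δ ≤
      (hpR d x y t x + hpR d x y t (p k) - d x (p k)) / 2 := by linarith
  have f2 := hyp x (p k) y
  have g2 := le_min g1' (hkP.trans' (by linarith))
  have f3 := g2.trans (sub_le_iff_le_add.1 f2)
  rw [rx, ry] at f3
  linarith

lemma wn_le (S : Set G) (l : List G) (h : ∀ x ∈ l, x ∈ S) : wordNorm S l.prod ≤ l.length := by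
  apply Nat.sInf_le
  exact ⟨l.get, fun i => h _ (List.get_mem _ _), by rw [List.ofFn_get]⟩

lemma wn_ex (S : Set G) (hS : GenSymm S) (w : G) :
    ∃ l : List G, (∀ x ∈ l, x ∈ S) ∧ l.prod = w ∧ l.length = wordNorm S w := by
  have hne : {k : ℕ | ∃ f : Fin k → G, (∀ i, f i ∈ S) ∧ (List.ofFn f).prod = w}.Nonempty := by
    have hw : w ∈ Subgroup.closure S := by rw [hS.2]; trivial
    rw [← Subgroup.mem_toSubmonoid, Subgroup.closure_toSubmonoid] at hw
    obtain ⟨l, hl, hp⟩ := Submonoid.exists_list_of_mem_closure hw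
    refine ⟨l.length, l.get, fun i => ?_, by rw [List.ofFn_get, hp]⟩
    rcases hl _ (List.get_mem l i) with h | h
    · exact h
    · simpa using hS.1 _ h
  obtain ⟨f, hf, hp⟩ := Nat.sInf_mem hne
  refine ⟨List.ofFn f, ?_, hp, ?_⟩
  · intro x hx
    rw [List.mem_ofFn] at hx
    obtain ⟨i, rfl⟩ := hx
    exact hf i
  · rw [List.length_ofFn]; rfl

lemma wn_mul (S : Set G) (hS : GenSymm S) (a b : G) :
    wordNorm S (a * b) ≤ wordNorm S a + wordNorm S b := by
  obtain ⟨l, hl, hp, hn⟩ := wn_ex S hS a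
  obtain ⟨l', hl', hp', hn'⟩ := wn_ex S hS b
  have := wn_le S (l ++ l') (by
    intro x hx
    rcases List.mem_append.1 hx with h | h
    · exact hl x h
    · exact hl' x h)
  rw [List.prod_append, hp, hp', List.length_append, hn, hn'] at this
  exact this

lemma hp_path (S : Set G) (hS : GenSymm S) (x y : G) : ∃ (n : ℕ) (p : ℕ → G),
    p 0 = x ∧ p n = y ∧ (∀ i, i < n → wordDist S (p i) (p (i + 1)) ≤ 1) ∧
    ∀ i j, i ≤ j → j ≤ n → ((j : ℝ) - i) ≤ wordDist S (p i) (p j) := by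
  obtain ⟨l, hl, hp, hn⟩ := wn_ex S hS (x⁻¹ * y)
  have hmid : ∀ i j, i ≤ j → (x * (l.take i).prod)⁻¹ * (x * (l.take j).prod)
      = ((l.take j).drop i).prod := by
    intro i j hij
    have : l.take j = l.take i ++ (l.take j).drop i := by
      conv_lhs => rw [← List.take_append_drop i (l.take j)]
      rw [List.take_take, min_eq_left hij]
    conv_lhs => rw [this]
    rw [List.prod_append]; group
  refine ⟨l.length, fun i => x * (l.take i).prod, by simp, by simp [hp], ?_, ?_⟩
  · intro i hi
    unfold wordDist
    rw [hmid i (i+1) (by omega)]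
    have := wn_le S ((l.take (i+1)).drop i)
      (fun z hz => hl z (List.mem_of_mem_take (List.mem_of_mem_drop hz)))
    have h2 : ((l.take (i+1)).drop i).length ≤ 1 := by simp
    exact_mod_cast this.trans h2
  · intro i j hij hj
    unfold wordDist
    rw [hmid i j hij]
    have h1 := wn_le S (l.take i) (fun z hz => hl z (List.mem_of_mem_take hz))
    have h2 := wn_le S (l.drop j) (fun z hz => hl z (List.mem_of_mem_drop hz))
    have h3 : (x⁻¹ * y) = (l.take i).prod * ((l.take j).drop i).prod * (l.drop j).prod := by
      rw [← hmid i j hij, ← hp]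
      conv_lhs => rw [← List.take_append_drop j l, List.prod_append]
      group
    have h4 := wn_mul S hS ((l.take i).prod * ((l.take j).drop i).prod) (l.drop j).prod
    have h5 := wn_mul S hS ((l.take i).prod) ((l.take j).drop i).prod
    rw [← h3, ← hn] at h4
    rw [List.length_take] at h1
    rw [List.length_drop] at h2
    have : j ≤ i + wordNorm S ((l.take j).drop i).prod := by omega
    have : (j : ℝ) ≤ i + wordNorm S ((l.take j).drop i).prod := by exact_mod_cast this
    linarith

lemma wn_inv_one (S : Set G) (x y : G) : wordDist S x y = wordNorm S (x⁻¹ * y) := rfl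

/-- Rough geodesicity. -/
lemma hp_mid {d : G → G → ℝ} (hd : InD d) : ∃ R : ℝ, 0 ≤ R ∧ ∀ x y : G, ∀ t, 0 ≤ t → t ≤ d x y →
    ∃ v, d x v ≤ t + R ∧ d v y ≤ d x y - t + R := by
  obtain ⟨hm, -, ⟨δ, hδ, hh⟩, S, hS, l1, l2, e, hl1, hl2, he, hq⟩ := hd
  obtain ⟨R0, hR0, hg⟩ := hp_growth (l1 * 6) (l1 * (2 * δ + e)) δ (1 + (l2 + e) / 2 + 2 * δ)
    (by positivity) hδ
  refine ⟨R0 + 1, by linarith, fun x y t t0 tD => ?_⟩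
  obtain ⟨n, p, p0, pn, ps, pq⟩ := hp_path (S : Set G) hS x y
  have hs : ∀ i, i < n → d (p i) (p (i + 1)) ≤ l2 + e := by
    intro i hi
    have h1 := (hq (p i) (p (i+1))).2
    have h2 := mul_le_mul_of_nonneg_left (ps i hi) hl2.le
    linarith
  have hqq : ∀ i j, i ≤ j → j ≤ n → ((j : ℝ) - i) ≤ l1 * (d (p i) (p j) + e) := by
    intro i j hij hj
    have h1 := (hq (p i) (p j)).1
    have h2 := pq i j hij hj
    have h3 : wordDist (S : Set G) (p i) (p j) / l1 ≤ d (p i) (p j) + e := by linarith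
    rw [div_le_iff₀ hl1] at h3
    linarith
  have desc : ∀ m : ℕ, (∀ t, 0 ≤ t → t ≤ d x y → ∃ i, i ≤ n ∧ hpR d x y t (p i) ≤ R0 + 1 + m) →
      (∀ t, 0 ≤ t → t ≤ d x y → ∃ i, i ≤ n ∧ hpR d x y t (p i) ≤ R0 + 1) := by
    intro m
    induction m with
    | zero => intro h; simpa using h
    | succ m ih =>
      intro h
      apply ih
      obtain ⟨κ, k1, k2⟩ := hg (R0 + 1 + (m + 1 : ℕ)) (by push_cast; linarith [Nat.cast_nonneg (α := ℝ) m])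
      have := hp_step (c := l2 + e) (l := l1) (e := e) hm hh hδ (by positivity) hl1.le
        (by push_cast; linarith [Nat.cast_nonneg (α := ℝ) m]) κ (by linarith) k2 x y n p p0 pn hs hqq h
      intro t t0 tD
      obtain ⟨i, hi, hi'⟩ := this t t0 tD
      refine ⟨i, hi, hi'.trans ?_⟩
      push_cast; linarith
  obtain ⟨m, hmn⟩ := exists_nat_ge (d x y)
  obtain ⟨i, hi, hi'⟩ := desc m (by
    intro t t0 tD
    refine ⟨0, Nat.zero_le _, ?_⟩
    rw [p0]
    unfold hpR
    rw [hm.1, hm.2.1 y x]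
    apply max_le <;> linarith) t t0 tD
  obtain ⟨a1, a2⟩ := max_le_iff.1 hi'
  refine ⟨p i, by linarith, ?_⟩
  rw [hm.2.1]; linarith

lemma hp_ball {d : G → G → ℝ} (hd : InD d) (r : ℝ) : {x : G | d x 1 ≤ r}.Finite := by
  obtain ⟨hm, -, -, S, hS, l1, l2, e, hl1, hl2, he, hq⟩ := hd
  obtain ⟨N, hN⟩ := exists_nat_ge (l1 * (r + e))
  have hfin : (⋃ k ∈ Set.Iic N, (fun l : List G => l.prod) ''
      {l : List G | l.length = k ∧ ∀ x ∈ l, x ∈ (S : Set G)}).Finite := by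
    apply Set.Finite.biUnion (Set.finite_Iic N)
    intro k _
    apply Set.Finite.image
    have := List.finite_length_eq S k
    refine (this.image (List.map Subtype.val)).subset ?_
    rintro l ⟨h1, h2⟩
    refine ⟨l.attach.map (fun z => ⟨z.1, h2 z.1 z.2⟩), by simpa using h1, ?_⟩
    simp [Function.comp_def]
  refine hfin.subset ?_
  intro x hx
  obtain ⟨l, hl, hp, hn⟩ := wn_ex (S : Set G) hS x
  have h1 := (hq 1 x).1
  rw [hm.2.1 1 x] at h1
  have h2 : wordDist (S : Set G) 1 x / l1 ≤ r + e := by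
    have : d x 1 ≤ r := hx
    linarith
  rw [div_le_iff₀ hl1] at h2
  have h3 : (wordNorm (S : Set G) x : ℝ) ≤ N := by
    have : wordDist (S : Set G) 1 x = wordNorm (S : Set G) x := by simp [wordDist]
    rw [← this]; linarith
  have h4 : wordNorm (S : Set G) x ≤ N := by exact_mod_cast h3
  simp only [Set.mem_iUnion]
  exact ⟨l.length, by simpa [hn] using h4, l, ⟨rfl, hl⟩, hp⟩

/-- A quasimorphism with finite fibres forces virtual cyclicity. -/
lemma hp_qm (β : G → ℝ) (Δ : ℝ) (hΔ : 0 ≤ Δ)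
    (hβ : ∀ g h, |β (g * h) - β g - β h| ≤ Δ)
    (hfin : ∀ K : ℝ, {g : G | |β g| ≤ K}.Finite) : ¬ NonElementary G := by
  intro hne
  apply hne
  by_cases hb : ∃ K, ∀ g, |β g| ≤ K
  · obtain ⟨K, hK⟩ := hb
    have hGf : Finite G := by
      have : {g : G | |β g| ≤ K} = Set.univ := by ext g; simp [hK g]
      rw [← Set.finite_univ_iff, ← this]; exact hfin K
    refine ⟨⊥, inferInstance, ?_⟩
    intro a ha b hb
    rw [Subgroup.mem_bot] at ha hb
    rw [ha, hb]
  · push Not at hb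
    have h1 : |β 1| ≤ Δ := by
      have := hβ 1 1
      rw [mul_one] at this
      rw [← abs_neg]
      convert this using 2; ring
    have ht : ∃ t, Δ + 1 ≤ β t := by
      obtain ⟨s, hs⟩ := hb (3 * Δ + 1)
      rcases lt_abs.1 hs with h | h
      · exact ⟨s, by linarith⟩
      · refine ⟨s⁻¹, ?_⟩
        have := hβ s s⁻¹
        rw [mul_inv_cancel] at this
        have := abs_le.1 this
        have := abs_le.1 h1
        linarith
    obtain ⟨t, ht⟩ := ht
    have desc : ∀ m : ℕ, ∀ g : G, |β g| ≤ β t + Δ + m → ∃ n : ℤ, |β (t ^ n * g)| ≤ β t + Δ := by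
      intro m
      induction m with
      | zero => intro g hg; exact ⟨0, by simpa using hg⟩
      | succ m ih =>
        intro g hg
        push_cast at hg
        have hm0 : (0:ℝ) ≤ m := Nat.cast_nonneg m
        by_cases hs : |β g| ≤ β t + Δ
        · exact ⟨0, by simpa using hs⟩
        · push Not at hs
          rcases lt_abs.1 hs with h | h
          · have e1 := abs_le.1 (hβ t (t⁻¹ * g))
            rw [mul_inv_cancel_left] at e1
            obtain ⟨n, hn⟩ := ih (t⁻¹ * g) (by
              have := abs_le.1 hg
              apply abs_le.2; constructor <;> linarith)
            refine ⟨n - 1, ?_⟩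
            rw [zpow_sub_one, mul_assoc]; exact hn
          · have e1 := abs_le.1 (hβ t g)
            obtain ⟨n, hn⟩ := ih (t * g) (by
              have := abs_le.1 hg
              apply abs_le.2; constructor <;> linarith)
            refine ⟨n + 1, ?_⟩
            rw [zpow_add_one, mul_assoc]; exact hn
    refine ⟨Subgroup.zpowers t, ?_, ?_⟩
    · have hF := hfin (β t + Δ)
      have : Finite (G ⧸ Subgroup.zpowers t) := by
        have := hF.to_subtype
        apply Finite.of_surjective
          (fun b : {g : G | |β g| ≤ β t + Δ} => ((b.1⁻¹ : G) : G ⧸ Subgroup.zpowers t))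
        intro q
        induction q using QuotientGroup.induction_on with
        | H g =>
          obtain ⟨m, hm⟩ := exists_nat_ge (|β g⁻¹|)
          obtain ⟨n, hn⟩ := desc m g⁻¹ (by linarith)
          refine ⟨⟨_, hn⟩, ?_⟩
          rw [QuotientGroup.eq]
          simp
      exact Subgroup.finiteIndex_of_finite_quotient
    · rintro a ⟨m, rfl⟩ b ⟨n, rfl⟩
      exact (Commute.refl t).zpow_zpow m n

/-- Comparison of Busemann-type differences. -/
lemma hp_buse {d : G → G → ℝ} {δ : ℝ} (hm : IsPseudometric d) (hh : GromovHyperbolic d δ)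
    (h u u' : G) (N : ℝ) (hN : N < gp d 1 u u') (hb : d h 1 + δ ≤ N) :
    d h u' - d 1 u' ≤ d h u - d 1 u + 2 * δ := by
  unfold gp at hN
  have s1 := hm.2.1 u 1
  have s2 := hm.2.1 u' 1
  have s3 := hm.2.1 u u'
  have t1 := hm.2.2 1 h u'
  have s4 := hm.2.1 h 1
  rcases hp_fp hh h u u' 1 with h1 | h1 <;> linarith

/-- Some bounded translate separates directions. -/
lemma hp_sep {d : G → G → ℝ} (hd : InD d) (hne : NonElementary G) :
    ∃ n : ℕ, ∀ u : G, ∃ h : G, d h 1 ≤ n ∧ gp d 1 (h * u) u ≤ n := by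
  by_contra hcon
  push Not at hcon
  choose u hu using hcon
  obtain ⟨R0, hR0, hmid⟩ := hp_mid hd
  have hball := hp_ball hd
  obtain ⟨hm, hL, ⟨δ, hδ, hh⟩, -⟩ := hd
  have hm0 := hm.1
  have hs := hm.2.1
  have htr := hm.2.2
  have hinv : ∀ g : G, d g⁻¹ 1 = d g 1 := by
    intro g
    have := hL g g⁻¹ 1
    rw [mul_inv_cancel, mul_one] at this
    rw [← this, hs]
  have hlim : ∀ g : G, ∃ b : ℝ, Tendsto (fun n => d g (u n) - d 1 (u n)) (hyperfilter ℕ) (𝓝 b) := by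
    intro g
    have hc : IsCompact (Set.Icc (-d g 1) (d g 1)) := isCompact_Icc
    have := hc.ultrafilter_le_nhds ((hyperfilter ℕ).map (fun n => d g (u n) - d 1 (u n))) (by
      rw [le_principal_iff, Ultrafilter.mem_coe, Ultrafilter.mem_map]
      apply Filter.univ_mem'
      intro n
      rw [Set.mem_preimage]
      have t1 := htr g 1 (u n)
      have t2 := htr 1 g (u n)
      have := hs 1 g
      constructor <;> linarith)
    obtain ⟨b, -, hb⟩ := this
    exact ⟨b, hb⟩
  choose β hβ using hlim
  have evN : ∀ N : ℝ, ∀ᶠ n : ℕ in (hyperfilter ℕ : Filter ℕ), N ≤ n := by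
    intro N
    have : ∀ᶠ n : ℕ in atTop, N ≤ n := tendsto_natCast_atTop_atTop.eventually_ge_atTop N
    exact (Nat.hyperfilter_le_atTop) this
  have ev : ∀ g h : G, ∀ᶠ n in (hyperfilter ℕ : Filter ℕ),
      |(d (g * h) (u n) - d 1 (u n)) - (d g (u n) - d 1 (u n)) - (d h (u n) - d 1 (u n))|
        ≤ 2 * δ := by
    intro g h
    filter_upwards [evN (d g 1), evN (d h 1 + δ)] with n n1 n2
    have e1 : d (g * h) (u n) = d h (g⁻¹ * u n) := by
      rw [← hL g h (g⁻¹ * u n), mul_inv_cancel_left]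
    have e2 : d g (u n) = d 1 (g⁻¹ * u n) := by
      rw [← hL g 1 (g⁻¹ * u n), mul_inv_cancel_left, mul_one]
    have e3 := hu n g⁻¹ (by rw [hinv]; exact n1)
    have e4 := hp_buse hm hh h (g⁻¹ * u n) (u n) n e3 n2
    have e5 : (n : ℝ) < gp d 1 (u n) (g⁻¹ * u n) := by
      unfold gp at e3 ⊢
      rw [hs (u n) (g⁻¹ * u n)]; linarith
    have e6 := hp_buse hm hh h (u n) (g⁻¹ * u n) n e5 n2
    rw [e1, e2, abs_le]
    constructor <;> linarith
  have hqm : ∀ g h, |β (g * h) - β g - β h| ≤ 2 * δ := by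
    intro g h
    have := (((hβ (g * h)).sub (hβ g)).sub (hβ h)).abs
    exact le_of_tendsto this (ev g h)
  have hβ1 : β 1 = 0 := by
    have := hβ 1
    simp only [sub_self] at this
    exact tendsto_nhds_unique this tendsto_const_nhds
  refine hp_qm β (2 * δ) (by positivity) hqm ?_ hne
  intro K
  set B := {x : G | d x 1 ≤ K + 2 * R0 + 6 * δ + 1 + R0 + R0} with hB
  have hBf : B.Finite := hball _
  by_contra hinf
  have hinf : Set.Infinite {g : G | |β g| ≤ K} := hinf
  obtain ⟨A, hAs, hAc⟩ := hinf.exists_subset_card_eq (hBf.toFinset.card + 1)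
  obtain ⟨T, hT0, hT⟩ : ∃ T : ℝ, 0 ≤ T ∧ ∀ g ∈ A, d g 1 ≤ T := by
    refine ⟨∑ g ∈ A, d g 1, Finset.sum_nonneg fun g _ => hp_nonneg hm g 1, fun g hg => ?_⟩
    exact Finset.single_le_sum (f := fun g => d g 1) (fun g _ => hp_nonneg hm g 1) hg
  have hev : ∀ᶠ n in (hyperfilter ℕ : Filter ℕ), ∀ g ∈ A,
      d g (u n) - d 1 (u n) ≤ K + 1 ∧ d g⁻¹ (u n) - d 1 (u n) ≤ K + 2 * δ + 1 := by
    rw [Filter.eventually_all_finset]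
    intro g hg
    have hg' : |β g| ≤ K := hAs hg
    have hg1 := abs_le.1 hg'
    have hg2 := abs_le.1 (hqm g g⁻¹)
    rw [mul_inv_cancel, hβ1] at hg2
    have a1 : β g < K + 1 := by linarith
    have a2 : β g⁻¹ < K + 2 * δ + 1 := by linarith
    filter_upwards [(hβ g).eventually (gt_mem_nhds a1), (hβ g⁻¹).eventually (gt_mem_nhds a2)]
      with n h1 h2
    exact ⟨h1.le, h2.le⟩
  obtain ⟨n, hn1, hn2⟩ := (hev.and (evN (T + R0 + δ))).exists
  have hun : (n : ℝ) < d 1 (u n) := by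
    have := hu n 1 (by rw [hm0]; positivity)
    unfold gp at this
    rw [one_mul, hm0] at this
    rw [hs]; linarith
  obtain ⟨v, hv1, hv2⟩ := hmid 1 (u n) T hT0 (by linarith)
  have hsv := hs v 1
  have hmaps : ∀ g ∈ A, v⁻¹ * g * v ∈ hBf.toFinset := by
    intro g hg
    rw [Set.Finite.mem_toFinset, hB, Set.mem_ofPred_eq]
    obtain ⟨b1, b2⟩ := hn1 g hg
    have hTg := hT g hg
    have e0 : d (v⁻¹ * g * v) 1 = d v (g * v) := by
      rw [← hL v (v⁻¹ * g * v) 1, hs]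
      congr 1 <;> group
    have e1 : d (g * v) (u n) = d v (g⁻¹ * u n) := by
      rw [← hL g v (g⁻¹ * u n), mul_inv_cancel_left]
    have e2 : d g (u n) = d 1 (g⁻¹ * u n) := by
      rw [← hL g 1 (g⁻¹ * u n), mul_inv_cancel_left, mul_one]
    have e3 := hu n g⁻¹ (by rw [hinv]; linarith)
    have e5 : (n : ℝ) < gp d 1 (u n) (g⁻¹ * u n) := by
      unfold gp at e3 ⊢
      rw [hs (u n) (g⁻¹ * u n)]; linarith
    have e6 := hp_buse hm hh v (u n) (g⁻¹ * u n) n e5 (by linarith)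
    have e7 : d 1 (g * v) = d g⁻¹ v := by
      rw [← hL g g⁻¹ v, mul_inv_cancel]
    have t1 := htr 1 v (u n)
    have hi := hinv g
    have hs1 := hs 1 v
    have hs2 := hs 1 (g * v)
    have hs3 := hs (u n) v
    have hgn := hp_nonneg hm g 1
    have e8 : d g⁻¹ v - d 1 v ≤ K + 4 * δ + 1 ∨ d g⁻¹ v - d 1 v ≤ 2 * R0 + 2 * δ + d g 1 - 2 * T := by
      rcases hp_fp hh g⁻¹ (u n) v 1 with h1 | h1
      · left
        have := hs (u n) 1
        linarith
      · right
        have := hs (u n) 1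
        linarith
    have hK : 0 ≤ K := (abs_nonneg _).trans (hAs hg : |β g| ≤ K)
    rw [e0]
    rcases hp_fp hh v 1 (g * v) (u n) with h1 | h1
    · linarith
    · rcases e8 with h2 | h2 <;> linarith
  have := Finset.card_le_card_of_injOn (fun g => v⁻¹ * g * v) hmaps (by
    intro a _ b _ hab
    simpa using hab)
  omega

lemma tlen_bdd {d : G → G → ℝ} (hm : IsPseudometric d) (x : G) :
    BddBelow {r : ℝ | ∃ n : ℕ, r = d (x ^ (n + 1)) 1 / (n + 1)} := by
  refine ⟨0, ?_⟩
  rintro r ⟨n, rfl⟩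
  have := hp_nonneg hm (x ^ (n + 1)) 1
  positivity

lemma tlen_le {d : G → G → ℝ} (hm : IsPseudometric d) (x : G) (n : ℕ) :
    tlen d x ≤ d (x ^ (n + 1)) 1 / (n + 1) := csInf_le (tlen_bdd hm x) ⟨n, rfl⟩

lemma le_tlen {d : G → G → ℝ} (x : G) (a : ℝ) (h : ∀ n : ℕ, a ≤ d (x ^ (n + 1)) 1 / (n + 1)) :
    a ≤ tlen d x := by
  refine le_csInf ⟨d (x ^ (0 + 1)) 1 / ((0 : ℕ) + 1), 0, rfl⟩ ?_
  rintro r ⟨n, rfl⟩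
  exact h n

lemma tlen_nonneg {d : G → G → ℝ} (hm : IsPseudometric d) (x : G) : 0 ≤ tlen d x := by
  apply le_tlen
  intro n
  have := hp_nonneg hm (x ^ (n + 1)) 1
  positivity

lemma hp_pow {d : G → G → ℝ} (hm : IsPseudometric d) (hL : LeftInvariant d) (x : G) (k : ℕ) :
    d (x ^ k) 1 ≤ k * d x 1 := by
  induction k with
  | zero => simp [hm.1]
  | succ k ih =>
    have h1 := hm.2.2 (x ^ (k + 1)) (x ^ k) 1
    have h2 := hL (x ^ k) x 1
    rw [mul_one, ← pow_succ] at h2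
    push_cast; linarith

lemma tlen_comp {d d' : G → G → ℝ} (hm : IsPseudometric d) (hm' : IsPseudometric d')
    (hL' : LeftInvariant d') (l A : ℝ) (hl : 0 < l) (hA : 0 ≤ A)
    (h : ∀ x y, d x y ≤ l * d' x y + A) (x : G) : tlen d x ≤ l * tlen d' x := by
  rw [← div_le_iff₀' hl]
  apply le_tlen
  intro n
  rw [div_le_iff₀' hl]
  apply le_of_forall_pos_le_add
  intro ε hε
  obtain ⟨k, hk⟩ := exists_nat_ge (A / ε)
  rw [div_le_iff₀ hε] at hk
  have h1 := tlen_le hm x ((n + 1) * (k + 1) - 1)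
  have hnk : (n + 1) * (k + 1) - 1 + 1 = (n + 1) * (k + 1) :=
    Nat.sub_add_cancel (Nat.mul_pos (Nat.succ_pos n) (Nat.succ_pos k))
  have hnk' : ((((n + 1) * (k + 1) - 1 : ℕ) : ℝ) + 1) = (n + 1) * (k + 1) := by
    exact_mod_cast hnk
  rw [hnk, hnk', pow_mul] at h1
  refine h1.trans ?_
  have h2 := h ((x ^ (n + 1)) ^ (k + 1)) 1
  have h3 := hp_pow hm' hL' (x ^ (n + 1)) (k + 1)
  have h4 := mul_le_mul_of_nonneg_left h3 hl.le
  push_cast at h4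
  have hn0 : (0:ℝ) ≤ n := Nat.cast_nonneg n
  have hk0 : (0:ℝ) ≤ k := Nat.cast_nonneg k
  rw [div_le_iff₀ (by positivity)]
  have h5 : (l * (d' (x ^ (n + 1)) 1 / (n + 1)) + ε) * ((n + 1) * (k + 1))
      = l * ((k + 1) * d' (x ^ (n + 1)) 1) + ε * ((n + 1) * (k + 1)) := by
    field_simp
  rw [h5]
  have : A ≤ ε * ((n + 1) * (k + 1)) := by
    have : 0 ≤ ε * n * (k + 1) := by positivity
    nlinarith
  linarith

lemma tlen_lower {d : G → G → ℝ} {δ : ℝ} (hm : IsPseudometric d) (hL : LeftInvariant d)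
    (hδ : 0 ≤ δ) (hh : GromovHyperbolic d δ) (x : G) :
    d (x ^ 2) 1 - d x 1 - 2 * δ ≤ tlen d x := by
  set k := d (x ^ 2) 1 - d x 1 - 2 * δ with hk
  rcases le_or_gt k 0 with h0 | h0
  · exact h0.trans (tlen_nonneg hm x)
  have hs := hm.2.1
  have inc : ∀ n : ℕ, d (x ^ (n + 1)) 1 + k ≤ d (x ^ (n + 2)) 1 := by
    intro n
    induction n with
    | zero => simp; linarith
    | succ n ih =>
      have e1 : d x (x ^ (n + 3)) = d (x ^ (n + 2)) 1 := by
        rw [hs _ 1, ← hL x 1 (x ^ (n + 2)), mul_one, ← pow_succ']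
      have e2 : d (x ^ 2) (x ^ (n + 3)) = d (x ^ (n + 1)) 1 := by
        rw [hs _ 1, ← hL (x ^ 2) 1 (x ^ (n + 1)), mul_one, ← pow_add]
        congr 2; ring
      have e3 : d x (x ^ 2) = d x 1 := by
        rw [hs x 1, ← hL x 1 x, mul_one, ← pow_two]
      have s1 := hs 1 (x ^ 2)
      have s2 := hs 1 x
      have s3 := hs 1 (x ^ (n + 3))
      show d (x ^ (n + 2)) 1 + k ≤ d (x ^ (n + 3)) 1
      rcases hp_fp hh 1 x (x ^ 2) (x ^ (n + 3)) with h1 | h1 <;> linarith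
  have low : ∀ n : ℕ, (n + 1) * k ≤ d (x ^ (n + 1)) 1 := by
    intro n
    induction n with
    | zero =>
      have := hp_pow hm hL x 2
      push_cast at this
      simp; linarith
    | succ n ih =>
      have := inc n
      push_cast
      show _ ≤ d (x ^ (n + 2)) 1
      linarith
  apply le_tlen
  intro n
  rw [le_div_iff₀ (by positivity), mul_comm]
  exact low n

/-- Every element is within bounded distance of one whose translation length is close to its norm. -/
lemma hp_key {d : G → G → ℝ} (hd : InD d) (hne : NonElementary G) :
    ∃ C : ℝ, 0 ≤ C ∧ ∀ g : G, ∃ f : G, d f 1 ≤ C ∧ d g 1 ≤ tlen d (g * f) + C := by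
  obtain ⟨n, hn⟩ := hp_sep hd hne
  obtain ⟨hm, hL, ⟨δ, hδ, hh⟩, -⟩ := hd
  have hs := hm.2.1
  have hinv : ∀ g : G, d g⁻¹ 1 = d g 1 := by
    intro g
    have := hL g g⁻¹ 1
    rw [mul_inv_cancel, mul_one] at this
    rw [← this, hs]
  have hsq : ∀ x : G, d x x⁻¹ = d (x ^ 2) 1 := by
    intro x
    have := hL x x x⁻¹
    rw [mul_inv_cancel, ← pow_two] at this
    exact this.symm
  have hn0 : (0:ℝ) ≤ n := Nat.cast_nonneg n
  refine ⟨6 * n + 6 * δ, by positivity, fun g => ?_⟩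
  obtain ⟨h, hh1, hh2⟩ := hn g⁻¹
  have h3 := hh (h * g⁻¹) g g⁻¹ 1
  have : gp d 1 (h * g⁻¹) g ≤ n + δ ∨ gp d 1 g g⁻¹ ≤ n + δ := by
    rcases min_choice (gp d 1 (h * g⁻¹) g) (gp d 1 g g⁻¹) with h4 | h4 <;> rw [h4] at h3
    · left; linarith
    · right; linarith
  rcases this with h4 | h4
  · refine ⟨h⁻¹, by rw [hinv]; linarith, ?_⟩
    have h5 := tlen_lower hm hL hδ hh (g * h⁻¹)
    have h6 := hsq (g * h⁻¹)
    have h7 := hinv (g * h⁻¹)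
    rw [show (g * h⁻¹)⁻¹ = h * g⁻¹ by group] at h6 h7
    unfold gp at h4
    have h8 := hL g h⁻¹ 1
    rw [mul_one, hinv] at h8
    have t1 := hm.2.2 g (g * h⁻¹) 1
    have t2 := hm.2.2 g (g * h⁻¹) (h * g⁻¹)
    have s1 := hs g (g * h⁻¹)
    have s2 := hs g (h * g⁻¹)
    linarith
  · refine ⟨1, by rw [hm.1]; positivity, ?_⟩
    have h5 := tlen_lower hm hL hδ hh g
    have h6 := hsq g
    have h7 := hinv g
    unfold gp at h4
    rw [mul_one]
    linarith

lemma wordDist_nonneg (S : Set G) (x y : G) : 0 ≤ wordDist S x y := Nat.cast_nonneg _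

/-- Word metrics are dominated by elements of `D(G)`. -/
lemma hp_dom {d d' : G → G → ℝ} (hd : InD d) (hd' : InD d') :
    ∃ l A : ℝ, 0 < l ∧ 0 ≤ A ∧ ∀ x y, d x y ≤ l * d' x y + A := by
  obtain ⟨hm, hL, -, S, hS, l1, l2, e, hl1, hl2, he, hq⟩ := hd
  obtain ⟨hm', hL', -, S', hS', l1', l2', e', hl1', hl2', he', hq'⟩ := hd'
  obtain ⟨M, hM0, hM⟩ : ∃ M : ℝ, 0 < M ∧ ∀ s ∈ S', d s 1 ≤ M := by
    refine ⟨∑ g ∈ S', d g 1 + 1, ?_, fun g hg => ?_⟩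
    · have := Finset.sum_nonneg (s := S') (f := fun g => d g 1) fun g _ => hp_nonneg hm g 1
      linarith
    · have := Finset.single_le_sum (f := fun g => d g 1) (fun g _ => hp_nonneg hm g 1) hg
      linarith
  have hlist : ∀ l : List G, (∀ x ∈ l, x ∈ (S' : Set G)) → d l.prod 1 ≤ M * l.length := by
    intro l
    induction l with
    | nil => intro _; simp [hm.1]
    | cons a l ih =>
      intro h
      have h1 := ih (fun x hx => h x (List.mem_cons_of_mem _ hx))
      have h2 := hM a (by simpa using h a List.mem_cons_self)
      have h3 := hm.2.2 (a * l.prod) a 1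
      have h4 := hL a l.prod 1
      rw [mul_one] at h4
      rw [List.prod_cons, List.length_cons]
      push_cast
      linarith
  refine ⟨M * l1', M * l1' * e', by positivity, by positivity, fun x y => ?_⟩
  obtain ⟨l, hl, hp, hn⟩ := wn_ex (S' : Set G) hS' (x⁻¹ * y)
  have h1 := hlist l hl
  have h2 := hL x (x⁻¹ * y) 1
  rw [mul_inv_cancel_left, mul_one] at h2
  rw [hp, ← h2, hn] at h1
  have h3 := (hq' x y).1
  have h4 : wordDist (S' : Set G) x y / l1' ≤ d' x y + e' := by linarith
  rw [div_le_iff₀ hl1'] at h4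
  unfold wordDist at h4
  have h5 := mul_le_mul_of_nonneg_left h4 hM0.le
  rw [hm.2.1 x y]
  linarith

lemma Dil_nonneg {d d' : G → G → ℝ} (hm : IsPseudometric d) (hm' : IsPseudometric d') :
    0 ≤ Dil d d' := by
  apply Real.sSup_nonneg
  rintro r ⟨x, -, rfl⟩
  exact div_nonneg (tlen_nonneg hm x) (tlen_nonneg hm' x)

lemma ratio_le {d d' : G → G → ℝ} (hm : IsPseudometric d) (hm' : IsPseudometric d')
    (hL' : LeftInvariant d') (l A : ℝ) (hl : 0 < l) (hA : 0 ≤ A)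
    (h : ∀ x y, d x y ≤ l * d' x y + A) (x : G) : tlen d x / tlen d' x ≤ l :=
  div_le_of_le_mul₀ (tlen_nonneg hm' x) hl.le (tlen_comp hm hm' hL' l A hl hA h x)

lemma Dil_le {d d' : G → G → ℝ} (hm : IsPseudometric d) (hm' : IsPseudometric d')
    (hL' : LeftInvariant d') (l A : ℝ) (hl : 0 < l) (hA : 0 ≤ A)
    (h : ∀ x y, d x y ≤ l * d' x y + A) : Dil d d' ≤ l := by
  apply Real.sSup_le _ hl.le
  rintro r ⟨x, -, rfl⟩
  exact ratio_le hm hm' hL' l A hl hA h x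

lemma tlen_finOrder {d : G → G → ℝ} (hm : IsPseudometric d) (x : G) (hx : IsOfFinOrder x) :
    tlen d x = 0 := by
  apply le_antisymm _ (tlen_nonneg hm x)
  obtain ⟨n, hn, hxn⟩ := isOfFinOrder_iff_pow_eq_one.1 hx
  have := tlen_le hm x (n - 1)
  rw [Nat.sub_add_cancel hn, hxn, hm.1, zero_div] at this
  exact this

lemma tlen_Dil {d d' : G → G → ℝ} (hd : InD d) (hd' : InD d') (x : G) :
    tlen d x ≤ Dil d d' * tlen d' x := by
  obtain ⟨l, A, hl, hA, h⟩ := hp_dom hd hd'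
  have hm := hd.1
  have hm' := hd'.1
  by_cases hx : IsOfFinOrder x
  · rw [tlen_finOrder hm x hx, tlen_finOrder hm' x hx, mul_zero]
  · rcases (tlen_nonneg hm' x).eq_or_lt with h0 | h0
    · have := tlen_comp hm hm' hd'.2.1 l A hl hA h x
      rw [← h0, mul_zero] at this
      rw [← h0, mul_zero]; exact this
    · rw [← div_le_iff₀ h0]
      apply le_csSup
      · refine ⟨l, ?_⟩
        rintro r ⟨x, -, rfl⟩
        exact ratio_le hm hm' hd'.2.1 l A hl hA h x
      · exact ⟨x, hx, rfl⟩

lemma Dil_dom {d d' : G → G → ℝ} (hd : InD d) (hd' : InD d') (hne : NonElementary G) :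
    ∃ A : ℝ, 0 ≤ A ∧ ∀ x y, d x y ≤ Dil d d' * d' x y + A := by
  obtain ⟨C, hC, hkey⟩ := hp_key hd hne
  obtain ⟨l, A, hl, hA, hdom⟩ := hp_dom hd' hd
  have hD := Dil_nonneg hd.1 hd'.1
  have hm := hd.1
  have hm' := hd'.1
  refine ⟨Dil d d' * (l * C + A) + C, by positivity, fun x y => ?_⟩
  have main : ∀ g, d g 1 ≤ Dil d d' * d' g 1 + (Dil d d' * (l * C + A) + C) := by
    intro g
    obtain ⟨f, hf, hg⟩ := hkey g
    have h1 := tlen_Dil hd hd' (g * f)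
    have h2 := tlen_le hm' (g * f) 0
    simp only [zero_add, pow_one, Nat.cast_zero, div_one] at h2
    have h3 := hm'.2.2 (g * f) g 1
    have h4 := hd'.2.1 g f 1
    rw [mul_one] at h4
    have h5 := hdom f 1
    have h6 := mul_le_mul_of_nonneg_left hf hl.le
    have h7 : tlen d' (g * f) ≤ d' g 1 + (l * C + A) := by linarith
    have h8 := mul_le_mul_of_nonneg_left h7 hD
    linarith
  have h1 := hd.2.1 x (x⁻¹ * y) 1
  have h2 := hd'.2.1 x (x⁻¹ * y) 1
  rw [mul_inv_cancel_left, mul_one] at h1 h2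
  rw [hm.2.1 x y, hm'.2.1 x y, h1, h2]
  exact main _

end Helpers

/-- For any representatives `d ∈ ρ`, `d' ∈ ρ'`,
`Λ(ρ,ρ') = Dil(d,d')·Dil(d',d)` (the quantity `Λ` is independent of representatives,
so it is computed here on representatives). -/
theorem Lam_eq_Dil_mul_Dil (G : Type*) [Group G]
    (hG : IsHyperbolicGroup G) (hne : NonElementary G)
    (d d' : G → G → ℝ) (hd : InD d) (hd' : InD d') :
    Lam d d' = Dil d d' * Dil d' d := by
  obtain ⟨A, hA, hAd⟩ := Dil_dom hd hd' hne
  obtain ⟨A', hA', hAd'⟩ := Dil_dom hd' hd hne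
  have hm := hd.1
  have hm' := hd'.1
  have hD := Dil_nonneg hm hm'
  have hD' := Dil_nonneg hm' hm
  have hmem : ∀ ε : ℝ, 0 < ε → (Dil d' d + ε) * (Dil d d' + ε) ∈
      {l : ℝ | ∃ l1 l2 A : ℝ, 0 < l1 ∧ 0 < l2 ∧ 0 ≤ A ∧ l = l1 * l2 ∧
        ∀ x y : G, d' x y / l1 - A ≤ d x y ∧ d x y ≤ l2 * d' x y + A} := by
    intro ε hε
    have hp : 0 < Dil d' d + ε := by linarith
    refine ⟨Dil d' d + ε, Dil d d' + ε, A + A' / (Dil d' d + ε), hp, by linarith, by positivity,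
      rfl, fun x y => ⟨?_, ?_⟩⟩
    · have h1 := hAd' x y
      have h2 := mul_nonneg hε.le (hp_nonneg hm x y)
      have h3 : d' x y / (Dil d' d + ε) ≤ d x y + A' / (Dil d' d + ε) := by
        rw [div_le_iff₀ hp, add_mul, div_mul_cancel₀ _ hp.ne']
        linarith
      linarith
    · have h1 := hAd x y
      have h2 := mul_nonneg hε.le (hp_nonneg hm' x y)
      have h3 : 0 ≤ A' / (Dil d' d + ε) := by positivity
      linarith
  have hlow : ∀ l ∈ {l : ℝ | ∃ l1 l2 A : ℝ, 0 < l1 ∧ 0 < l2 ∧ 0 ≤ A ∧ l = l1 * l2 ∧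
        ∀ x y : G, d' x y / l1 - A ≤ d x y ∧ d x y ≤ l2 * d' x y + A},
      Dil d d' * Dil d' d ≤ l := by
    rintro l ⟨l1, l2, B, hl1, hl2, hB, rfl, h⟩
    have h1 := Dil_le hm hm' hd'.2.1 l2 B hl2 hB (fun x y => (h x y).2)
    have h2 := Dil_le hm' hm hd.2.1 l1 (l1 * B) hl1 (by positivity) (fun x y => by
      have h3 := (h x y).1
      have h4 : d' x y / l1 ≤ d x y + B := by linarith
      rw [div_le_iff₀ hl1] at h4
      linarith)
    rw [mul_comm l1 l2]
    exact mul_le_mul h1 h2 hD' hl2.le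
  apply le_antisymm
  · have hlim : Tendsto (fun ε : ℝ => (Dil d' d + ε) * (Dil d d' + ε)) (𝓝[>] 0)
        (𝓝 ((Dil d' d + 0) * (Dil d d' + 0))) := by
      apply Tendsto.mono_left _ nhdsWithin_le_nhds
      exact Continuous.tendsto (by fun_prop) 0
    rw [add_zero, add_zero, mul_comm (Dil d' d)] at hlim
    refine ge_of_tendsto hlim ?_
    filter_upwards [self_mem_nhdsWithin] with ε hε
    exact csInf_le ⟨_, hlow⟩ (hmem ε hε)
  · exact le_csInf ⟨_, hmem 1 one_pos⟩ hlow

end
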